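/- arXiv:1908.03672 — 2 statements merged into one kernel-verified Lean document; each statement's English description precedes it below -/
import Mathlib

section
/- For any even integer $n \ge 2$ (resp. odd $n \ge 1$), there is a unique $n$-cocycle $\epsilon_n^W \in Z^n(W,\mathbb{Z})$ (resp. $Z^n(W,\mathbb{F}_2)$), with $W$ acting trivially on coefficients, satisfying: (1) $\epsilon_n^W(x_1,\ldots,x_n) = 0$ whenever $|x_i x_{i+1}| = |x_i| + |x_{i+1}|$ for some $1 \le i \le n-1$ (if $n \ge 2$); and (2) $\epsilon_n^W(s,\ldots,s) = 1$ for every $s \in S$. -/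
open CoxeterSystem

variable {B W : Type*} [Group W] {M : CoxeterMatrix B}

/-- Given an `(n+1)`-tuple `(x₀, …, xₙ)`, the `n`-tuple obtained by multiplying the
`j`-th and `(j+1)`-st entries: `(x₀, …, x_{j-1}, x_j · x_{j+1}, x_{j+2}, …, xₙ)`. -/
def contract {n : ℕ} (x : Fin (n + 1) → W) (j : Fin n) : Fin n → W :=
  fun i =>
    if (i : ℕ) < (j : ℕ) then x i.castSucc
    else if i = j then x i.castSucc * x i.succ
    else x i.succ

/-- `ζ` is an `n`-cocycle for the group cohomology of `W` with coefficients in the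
abelian group `A` with trivial `W`-action: `(δζ) = 0`. -/
def IsCocycle {A : Type*} [AddCommGroup A] (n : ℕ) (ζ : (Fin n → W) → A) : Prop :=
  ∀ x : Fin (n + 1) → W,
    ζ (x ∘ Fin.succ)
      + ∑ j : Fin n, ((-1 : ℤ) ^ ((j : ℕ) + 1)) • ζ (contract x j)
      + ((-1 : ℤ) ^ (n + 1)) • ζ (x ∘ Fin.castSucc) = 0

/-- `ζ` is an `n`-cocycle for the group cohomology of `W` with coefficients in the
`ℤ[W]`-module `A`: `(δζ) = 0`. -/
def IsCocycleM {A : Type*} [AddCommGroup A] [DistribMulAction W A] (n : ℕ)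
    (ζ : (Fin n → W) → A) : Prop :=
  ∀ x : Fin (n + 1) → W,
    x 0 • ζ (x ∘ Fin.succ)
      + ∑ j : Fin n, ((-1 : ℤ) ^ ((j : ℕ) + 1)) • ζ (contract x j)
      + ((-1 : ℤ) ^ (n + 1)) • ζ (x ∘ Fin.castSucc) = 0

/-- `ζ` is collapsing: it vanishes on tuples where two consecutive entries have
additive lengths. -/
def Collapsing (cs : CoxeterSystem M W) {A : Type*} [AddCommGroup A] (n : ℕ)
    (ζ : (Fin n → W) → A) : Prop :=
  ∀ x : Fin n → W, ∀ i : Fin n, ∀ hi : (i : ℕ) + 1 < n,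
    cs.length (x i * x ⟨(i : ℕ) + 1, hi⟩) =
        cs.length (x i) + cs.length (x ⟨(i : ℕ) + 1, hi⟩) →
      ζ x = 0

/-- `ζ` is the canonical cocycle `ε_n^W`: a collapsing `n`-cocycle (trivial coefficients)
taking the value `1` on `(s, …, s)` for every simple reflection `s`. -/
def IsEps (cs : CoxeterSystem M W) {A : Type*} [AddCommGroup A] [One A] (n : ℕ)
    (ζ : (Fin n → W) → A) : Prop :=
  IsCocycle n ζ ∧ Collapsing cs n ζ ∧ ∀ i : B, ζ (fun _ => cs.simple i) = 1

/-- The prefix product `x₀ ⋯ x_{k-1}`. -/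
def pp {n : ℕ} (x : Fin n → W) (k : ℕ) : W := ((List.ofFn x).take k).prod

/-! ### Uniqueness -/

section Uniqueness

lemma eps_isolate {A : Type*} [AddCommGroup A] {n : ℕ} {ζ : (Fin n → W) → A}
    (hζ : IsCocycle n ζ) (y : Fin (n + 1) → W) (j₀ : Fin n)
    (h0 : ζ (y ∘ Fin.succ) = 0) (h1 : ζ (y ∘ Fin.castSucc) = 0)
    (h2 : ∀ j, j ≠ j₀ → ζ (contract y j) = 0) : ζ (contract y j₀) = 0 := by
  have h := hζ y
  rw [h0, h1, Finset.sum_eq_single j₀ (fun j _ hj => by rw [h2 j hj, smul_zero])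
    (fun h => absurd (Finset.mem_univ _) h)] at h
  rcases neg_one_pow_eq_or ℤ ((j₀ : ℕ) + 1) with h' | h' <;> simpa [h'] using h

lemma eps_step (cs : CoxeterSystem M W) {A : Type*} [AddCommGroup A] {n : ℕ}
    {ζ : (Fin n → W) → A} (hζ : IsCocycle n ζ) (hc : Collapsing cs n ζ) (i : B) (b : W)
    (hb : cs.length (cs.simple i * b) = cs.length b + 1)
    (k : ℕ) (hk : k < n)
    (ih : ∀ x : Fin n → W, (∀ m : Fin n, (m : ℕ) ≤ k → x m = cs.simple i) → ζ x = 0)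
    (x : Fin n → W) (hx : ∀ m : Fin n, (m : ℕ) < k → x m = cs.simple i)
    (hxk : x ⟨k, hk⟩ = cs.simple i * b)
    (h0 : k = 0 → ∀ x' : Fin n → W, x' ⟨k, hk⟩ = b → ζ x' = 0) : ζ x = 0 := by
  have hb' : cs.length (cs.simple i * b) = cs.length (cs.simple i) + cs.length b := by
    rw [hb, cs.length_simple, add_comm]
  let y : Fin (n + 1) → W := fun m =>
    if (m : ℕ) ≤ k then cs.simple i else if (m : ℕ) = k + 1 then b else
      if h : (m : ℕ) - 1 < n then x ⟨(m : ℕ) - 1, h⟩ else 1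
  have hy : contract y ⟨k, hk⟩ = x := by
    funext m
    obtain ⟨m, hm⟩ := m
    rcases lt_trichotomy m k with h | rfl | h
    · have := hx ⟨m, hm⟩ h
      simp [contract, y, h, h.le, this]
    · simp [contract, y, hxk]
    · have h1 : ¬ m < k := by omega
      have h2 : m ≠ k := by omega
      have h3 : ¬ m + 1 ≤ k := by omega
      simp [contract, y, h1, h2, h3, hm]
  rw [← hy]
  apply eps_isolate hζ
  · rcases Nat.eq_zero_or_pos k with h | h
    · apply h0 h
      simp [y]
    · apply hc _ ⟨k - 1, by omega⟩ (by simp; omega)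
      have h1 : k - 1 + 1 = k := by omega
      simpa [y, h1] using hb'
  · by_cases h : k + 1 < n
    · apply hc _ ⟨k, hk⟩ h
      simpa [y] using hb'
    · apply ih
      intro m hm
      simp [y, hm]
  · rintro ⟨j, hj⟩ hjk
    have hjk : j ≠ k := by simpa using hjk
    rcases lt_or_gt_of_ne hjk with h | h
    · apply hc _ ⟨j, hj⟩ (by simp; omega)
      have h1 : j ≤ k := by omega
      have h2 : j + 1 ≤ k := by omega
      simp [contract, y, h1, h2]
    · by_cases h' : j = k + 1
      · apply ih
        intro m hm
        have h1 : (m : ℕ) < j := by omega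
        simp [contract, y, h1, hm]
      · apply hc _ ⟨k, hk⟩ (by simp; omega)
        have h1 : k + 1 < j := by omega
        simpa [contract, y, h, h1] using hb'

lemma eps_prefix (cs : CoxeterSystem M W) {A : Type*} [AddCommGroup A] {n : ℕ}
    {ζ : (Fin n → W) → A} (hζ : IsCocycle n ζ) (hc : Collapsing cs n ζ)
    (hs : ∀ i : B, ζ (fun _ => cs.simple i) = 0) (i : B) (d : ℕ) :
    ∀ k, k + d = n → 1 ≤ k → ∀ x : Fin n → W,
      (∀ m : Fin n, (m : ℕ) < k → x m = cs.simple i) → ζ x = 0 := by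
  induction d with
  | zero =>
    intro k hk _ x hx
    have : x = fun _ => cs.simple i := funext fun m => hx m (by omega)
    rw [this, hs]
  | succ d ih =>
    intro k hk hk1 x hx
    have hkn : k < n := by omega
    rcases cs.length_simple_mul (x ⟨k, hkn⟩) i with h | h
    · apply hc x ⟨k - 1, by omega⟩ (by simp; omega)
      have h1 : k - 1 + 1 = k := by omega
      have h2 : x ⟨k - 1, by omega⟩ = cs.simple i := hx _ (by simp; omega)
      simp only [h1, h2]
      rw [h, cs.length_simple, add_comm]
    · refine eps_step cs hζ hc i (cs.simple i * x ⟨k, hkn⟩) (by simp [h]) k hkn ?_ x hx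
        (by simp) (fun h => by omega)
      intro x' hx'
      exact ih (k + 1) (by omega) (by omega) x' (fun m hm => hx' m (by omega))

lemma eps_zero (cs : CoxeterSystem M W) {A : Type*} [AddCommGroup A] {n : ℕ} (hn : 1 ≤ n)
    {ζ : (Fin n → W) → A} (hζ : IsCocycle n ζ) (hc : Collapsing cs n ζ)
    (hs : ∀ i : B, ζ (fun _ => cs.simple i) = 0) (l : ℕ) :
    ∀ x : Fin n → W, cs.length (x ⟨0, hn⟩) = l → ζ x = 0 := by
  induction l using Nat.strong_induction_on with
  | _ l ih =>
    intro x hx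
    by_cases h1 : x ⟨0, hn⟩ = 1
    · rcases Nat.lt_or_ge 1 n with h | h
      · apply hc x ⟨0, hn⟩ h
        simp [h1]
      · obtain rfl : n = 1 := by omega
        have h2 : x = fun _ => 1 := by
          funext m
          rw [Subsingleton.elim m ⟨0, hn⟩, h1]
        have h3 := hζ (fun _ => 1)
        have h4 : contract (fun _ : Fin 2 => (1 : W)) (0 : Fin 1) = fun _ => 1 := by
          funext m
          simp [contract]
        simp only [Finset.univ_unique, Finset.sum_singleton, Fin.default_eq_zero, h4,
          Function.comp_def] at h3
        rw [h2]
        simpa using h3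
    · obtain ⟨i, hi⟩ := cs.exists_leftDescent_of_ne_one h1
      rw [cs.isLeftDescent_iff] at hi
      refine eps_step cs hζ hc i (cs.simple i * x ⟨0, hn⟩) (by simp [hi]) 0 hn ?_ x
        (by simp) (by simp) ?_
      · intro x' hx'
        exact eps_prefix cs hζ hc hs i (n - 1) 1 (by omega) le_rfl x'
          (fun m hm => hx' m (by omega))
      · intro _ x' hx'
        exact ih (cs.length (cs.simple i * x ⟨0, hn⟩)) (by omega) x' (by rw [hx'])

lemma eps_unique (cs : CoxeterSystem M W) {A : Type*} [AddCommGroup A] {n : ℕ} (hn : 1 ≤ n)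
    (c : A) {ζ ξ : (Fin n → W) → A} (hζ : IsCocycle n ζ) (hc : Collapsing cs n ζ)
    (hs : ∀ i : B, ζ (fun _ => cs.simple i) = c) (hξ : IsCocycle n ξ) (hc' : Collapsing cs n ξ)
    (hs' : ∀ i : B, ξ (fun _ => cs.simple i) = c) : ζ = ξ := by
  funext x
  rw [← sub_eq_zero]
  refine eps_zero cs hn (ζ := fun x => ζ x - ξ x) ?_ ?_ ?_ _ x rfl
  · intro y
    have h1 := hζ y
    have h2 := hξ y
    simp only [smul_sub, Finset.sum_sub_distrib]
    rw [← sub_eq_zero.mpr (h1.trans h2.symm)]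
    abel
  · intro y i hi h
    simp only [hc y i hi h, hc' y i hi h, sub_zero]
  · intro i
    simp only [hs, hs', sub_self]

end Uniqueness

/-! ### The reflection cocycle -/

section Reflection

open Classical in
/-- The action of a simple reflection on pairs (element, sign). -/
noncomputable def epsAct (cs : CoxeterSystem M W) (i : B) : Function.End (W × ℤˣ) :=
  fun p => (cs.simple i * p.1 * (cs.simple i)⁻¹, p.2 * if p.1 = cs.simple i then -1 else 1)

lemma epsAct_conj (cs : CoxeterSystem M W) (i j : B) (p : ℕ) :
    (cs.simple i * cs.simple j) ^ p * cs.simple j * (cs.simple i * cs.simple j) ^ p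
      = cs.simple j := by
  induction p with
  | zero => simp
  | succ p ih =>
    have h1 := pow_succ (cs.simple i * cs.simple j) p
    have h2 := pow_succ' (cs.simple i * cs.simple j) p
    calc _ = (cs.simple i * cs.simple j) ^ p * (cs.simple i * cs.simple j) * cs.simple j *
          ((cs.simple i * cs.simple j) * (cs.simple i * cs.simple j) ^ p) := by rw [← h1, ← h2]
      _ = (cs.simple i * cs.simple j) ^ p * (cs.simple i * (cs.simple j * cs.simple j)
          * cs.simple i) * cs.simple j * (cs.simple i * cs.simple j) ^ p := by simp only [mul_assoc]
      _ = _ := by simpa using ih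

open Classical in
lemma epsAct_pow (cs : CoxeterSystem M W) (i j : B) (p : ℕ) (t : W) (e : ℤˣ) :
    ((epsAct cs i * epsAct cs j) ^ p) (t, e) =
      ((cs.simple i * cs.simple j) ^ p * t * ((cs.simple i * cs.simple j) ^ p)⁻¹,
        e * ∏ k ∈ Finset.range (2 * p),
          if t = cs.simple j * (cs.simple i * cs.simple j) ^ k then (-1 : ℤˣ) else 1) := by
  induction p with
  | zero => simp; rfl
  | succ p ih =>
    rw [pow_succ']
    change epsAct cs i (epsAct cs j (((epsAct cs i * epsAct cs j) ^ p) (t, e))) = _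
    rw [ih]
    have hR := epsAct_conj cs i j p
    have hR1 := epsAct_conj cs i j 1
    rw [pow_one] at hR1
    simp only [epsAct]
    have hr : (cs.simple i * cs.simple j) ^ (p + 1)
        = cs.simple i * cs.simple j * (cs.simple i * cs.simple j) ^ p := pow_succ' _ _
    rw [hr, show 2 * (p + 1) = 2 * p + 1 + 1 by ring, Finset.prod_range_succ,
      Finset.prod_range_succ]
    have e1 : ((cs.simple i * cs.simple j) ^ p * t * ((cs.simple i * cs.simple j) ^ p)⁻¹
        = cs.simple j) ↔ t = cs.simple j * (cs.simple i * cs.simple j) ^ (2 * p) := by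
      rw [mul_inv_eq_iff_eq_mul, two_mul, pow_add]
      nth_rewrite 2 [← hR]
      constructor
      · intro h
        have := mul_left_cancel (h.trans ?_ :
          (cs.simple i * cs.simple j) ^ p * t = (cs.simple i * cs.simple j) ^ p *
          (cs.simple j * ((cs.simple i * cs.simple j) ^ p * (cs.simple i * cs.simple j) ^ p)))
        · exact this
        · group
      · rintro rfl
        group
    have e2 : (cs.simple j * ((cs.simple i * cs.simple j) ^ p * t *
        ((cs.simple i * cs.simple j) ^ p)⁻¹) * (cs.simple j)⁻¹ = cs.simple i)
        ↔ t = cs.simple j * (cs.simple i * cs.simple j) ^ (2 * p + 1) := by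
      have hinv : (cs.simple i * cs.simple j) ^ p * cs.simple j =
          cs.simple j * ((cs.simple i * cs.simple j) ^ p)⁻¹ := by
        rw [eq_mul_inv_iff_mul_eq, hR]
      have hinv' : ((cs.simple i * cs.simple j) ^ p)⁻¹ * cs.simple j =
          cs.simple j * (cs.simple i * cs.simple j) ^ p := by
        rw [inv_mul_eq_iff_eq_mul, ← mul_assoc, hR]
      have hX : cs.simple j * (cs.simple i * cs.simple j) ^ (2 * p + 1) =
          (cs.simple j * (cs.simple i * cs.simple j) ^ p)⁻¹ * cs.simple i *
          (cs.simple j * (cs.simple i * cs.simple j) ^ p) := by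
        rw [mul_inv_rev, cs.inv_simple, hinv', show 2 * p + 1 = p + 1 + p by ring, pow_add, pow_add,
          pow_one]
        simp only [mul_assoc]
      rw [hX]
      constructor
      · intro h
        nth_rewrite 2 [← h]
        group
      · rintro rfl
        group
    simp only [e1, e2]
    refine Prod.ext ?_ ?_
    · simp only [mul_inv_rev, mul_assoc]
    · simp only [mul_assoc]

lemma epsAct_liftable (cs : CoxeterSystem M W) : M.IsLiftable (epsAct cs) := by
  classical
  intro i j
  funext ⟨t, e⟩
  rw [epsAct_pow, cs.simple_mul_simple_pow, two_mul, Finset.prod_range_add]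
  simp only [pow_add, cs.simple_mul_simple_pow, one_mul, inv_one, mul_one]
  rw [Int.units_mul_self, mul_one]
  rfl

lemma eps_refl (cs : CoxeterSystem M W) : ∃ η : W → W → ℤˣ,
    (∀ x y t, η (x * y) t = η x t * η y (x⁻¹ * t * x)) ∧
    (∀ i t, t ≠ cs.simple i → η (cs.simple i) t = 1) ∧
    (∀ i, η (cs.simple i) (cs.simple i) = -1) := by
  classical
  let φ := cs.lift ⟨epsAct cs, epsAct_liftable cs⟩
  have hφ : ∀ i, φ (cs.simple i) = epsAct cs i := cs.lift_apply_simple _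
  have key : ∀ w t e, φ w (t, e) = (w * t * w⁻¹, e * (φ w (t, 1)).2) := by
    intro w
    induction w using cs.simple_induction_left with
    | one =>
      intro t e
      rw [map_one]
      change (t, e) = (1 * t * 1⁻¹, e * 1)
      simp
    | mul_simple_left w i ih =>
      intro t e
      rw [map_mul]
      change φ _ (φ w (t, e)) = (_, e * (φ (cs.simple i) (φ w (t, 1))).2)
      rw [ih t e, ih t 1, hφ]
      simp only [epsAct]
      refine Prod.ext ?_ ?_
      · simp [mul_assoc]
      · simp [mul_assoc]
  refine ⟨fun w t => (φ w⁻¹ (t, 1)).2, ?_, ?_, ?_⟩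
  · intro x y t
    simp only [mul_inv_rev, map_mul]
    change (φ y⁻¹ (φ x⁻¹ (t, 1))).2 = _
    rw [key x⁻¹ t 1, key y⁻¹]
    simp
  · intro i t ht
    simp [hφ, epsAct, ht]
  · intro i
    simp [hφ, epsAct]

lemma eps_lis_append (cs : CoxeterSystem M W) (ω ω' : List B) :
    cs.leftInvSeq (ω ++ ω') =
      cs.leftInvSeq ω ++ (cs.leftInvSeq ω').map (MulAut.conj (cs.wordProd ω)) := by
  induction ω with
  | nil => simp
  | cons i ω ih =>
    simp [leftInvSeq, ih, cs.wordProd_cons, Function.comp_def]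

lemma eps_refl' (cs : CoxeterSystem M W) : ∃ η : W → W → ℤˣ,
    (∀ x y t, η (x * y) t = η x t * η y (x⁻¹ * t * x)) ∧
    (∀ i t, t ≠ cs.simple i → η (cs.simple i) t = 1) ∧
    (∀ i, η (cs.simple i) (cs.simple i) = -1) ∧
    (∀ w, {t | η w t ≠ 1}.Finite) ∧
    (∀ x y, cs.length (x * y) = cs.length x + cs.length y → ∀ t, η x t ≠ 1 →
      η y (x⁻¹ * t * x) = 1) := by
  obtain ⟨η, h1, h2, h3⟩ := eps_refl cs
  have hone : ∀ t, η 1 t = 1 := by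
    intro t
    have := h1 1 1 t
    simpa using this
  have hmem : ∀ ω t, η (cs.wordProd ω) t ≠ 1 → t ∈ cs.leftInvSeq ω := by
    intro ω
    induction ω with
    | nil => intro t h; simp [hone] at h
    | cons i ω ih =>
      intro t h
      rw [cs.wordProd_cons, h1] at h
      by_cases ht : t = cs.simple i
      · simp [leftInvSeq, ht]
      · rw [h2 i t ht, one_mul] at h
        have := ih _ h
        simp only [leftInvSeq, List.mem_cons, List.mem_map]
        exact Or.inr ⟨_, this, by simp [mul_assoc]⟩
  refine ⟨η, h1, h2, h3, ?_, ?_⟩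
  · intro w
    obtain ⟨ω, -, rfl⟩ := cs.exists_isReduced w
    exact (List.finite_toSet (cs.leftInvSeq ω)).subset (fun t ht => hmem ω t ht)
  · intro x y hxy t ht
    obtain ⟨ω, hω, rfl⟩ := cs.exists_isReduced x
    obtain ⟨ω', hω', rfl⟩ := cs.exists_isReduced y
    by_contra h
    have hr : cs.IsReduced (ω ++ ω') := by
      unfold CoxeterSystem.IsReduced
      rw [cs.wordProd_append, hxy, hω.eq, hω'.eq, List.length_append]
    have hn := hr.nodup_leftInvSeq
    rw [eps_lis_append, List.nodup_append] at hn
    refine hn.2.2 t (hmem ω t ht) t ?_ rfl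
    rw [List.mem_map]
    exact ⟨_, hmem ω' _ h, by simp [mul_assoc]⟩

end Reflection

/-! ### Existence -/

section Existence

/-- Indicator of nontrivial signs. -/
def epsU (g : ℤˣ) : ℤ := if g = 1 then 0 else 1

lemma epsU_mul (g h : ℤˣ) : epsU (g * h) = epsU g + epsU h - 2 * epsU g * epsU h := by
  rcases Int.units_eq_one_or g with rfl | rfl <;> rcases Int.units_eq_one_or h with rfl | rfl <;>
    decide

/-- The contribution of the wall `t`. -/
def epsE (η : W → W → ℤˣ) : (n : ℕ) → (Fin n → W) → W → ℤ
  | 0, _, _ => 1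
  | n + 1, x, t => epsU (η (x 0) t) * epsE η n (x ∘ Fin.succ) ((x 0)⁻¹ * t * x 0)

lemma epsE_delta (η : W → W → ℤˣ) (h1 : ∀ x y t, η (x * y) t = η x t * η y (x⁻¹ * t * x))
    (n : ℕ) : ∀ (x : Fin (n + 1) → W) (t : W),
    epsE η n (x ∘ Fin.succ) ((x 0)⁻¹ * t * x 0)
      + ∑ j : Fin n, ((-1 : ℤ) ^ ((j : ℕ) + 1)) • epsE η n (contract x j) t
      + ((-1 : ℤ) ^ (n + 1)) • epsE η n (x ∘ Fin.castSucc) t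
      = (1 - (-1) ^ n) * epsE η (n + 1) x t := by
  induction n with
  | zero => intro x t; simp [epsE]
  | succ n ih =>
    intro x t
    have ih' := ih (x ∘ Fin.succ) ((x 0)⁻¹ * t * x 0)
    have c0 : epsE η (n + 1) (contract x 0) t = epsU (η (x 0 * x 1) t) *
        epsE η n ((x ∘ Fin.succ) ∘ Fin.succ) ((x 1)⁻¹ * ((x 0)⁻¹ * t * x 0) * x 1) := by
      have e1 : contract x 0 ∘ Fin.succ = (x ∘ Fin.succ) ∘ Fin.succ := by
        funext m
        simp [contract]
      have e2 : contract x 0 0 = x 0 * x 1 := by simp [contract]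
      rw [epsE, e1, e2]
      simp only [mul_inv_rev, mul_assoc]
    have cs : ∀ j : Fin n, epsE η (n + 1) (contract x j.succ) t = epsU (η (x 0) t) *
        epsE η n (contract (x ∘ Fin.succ) j) ((x 0)⁻¹ * t * x 0) := by
      intro j
      have e1 : contract x j.succ ∘ Fin.succ = contract (x ∘ Fin.succ) j := by
        funext m
        simp [contract]
      have e2 : contract x j.succ 0 = x 0 := by simp [contract]
      rw [epsE, e1, e2]
    have cl : epsE η (n + 1) (x ∘ Fin.castSucc) t = epsU (η (x 0) t) *
        epsE η n ((x ∘ Fin.succ) ∘ Fin.castSucc) ((x 0)⁻¹ * t * x 0) := by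
      rw [epsE]
      rfl
    rw [Fin.sum_univ_succ, cl, c0, h1, epsU_mul]
    simp only [cs]
    have e3 : epsE η (n + 1) (x ∘ Fin.succ) ((x 0)⁻¹ * t * x 0) =
        epsU (η (x 1) ((x 0)⁻¹ * t * x 0)) *
        epsE η n ((x ∘ Fin.succ) ∘ Fin.succ) ((x 1)⁻¹ * ((x 0)⁻¹ * t * x 0) * x 1) := rfl
    have e4 : epsE η (n + 1 + 1) x t = epsU (η (x 0) t) *
        epsE η (n + 1) (x ∘ Fin.succ) ((x 0)⁻¹ * t * x 0) := rfl
    rw [e4]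
    have e5 : (x ∘ Fin.succ) 0 = x 1 := rfl
    rw [e5, e3] at ih'
    rw [e3]
    simp only [smul_eq_mul, Fin.val_succ, Fin.val_zero] at ih' ⊢
    have e6 : ∀ j : Fin n, (-1 : ℤ) ^ ((j : ℕ) + 1 + 1) * (epsU (η (x 0) t) *
        epsE η n (contract (x ∘ Fin.succ) j) ((x 0)⁻¹ * t * x 0)) = - epsU (η (x 0) t) *
        ((-1) ^ ((j : ℕ) + 1) *
        epsE η n (contract (x ∘ Fin.succ) j) ((x 0)⁻¹ * t * x 0)) := by
      intro j; ring
    simp only [e6, ← Finset.mul_sum]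
    linear_combination (- epsU (η (x 0) t)) * ih'

/-- The integral cochain. -/
noncomputable def epsZ (η : W → W → ℤˣ) (n : ℕ) (x : Fin n → W) : ℤ := ∑ᶠ t, epsE η n x t

lemma epsE_finite (η : W → W → ℤˣ) (hf : ∀ w, {t | η w t ≠ 1}.Finite) (n : ℕ) (hn : 1 ≤ n)
    (x : Fin n → W) : (Function.support (epsE η n x)).Finite := by
  obtain ⟨n, rfl⟩ : ∃ k, n = k + 1 := ⟨n - 1, by omega⟩
  refine (hf (x 0)).subset ?_
  intro t ht h
  apply ht
  simp [epsE, epsU, h]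

lemma epsZ_delta (η : W → W → ℤˣ) (h1 : ∀ x y t, η (x * y) t = η x t * η y (x⁻¹ * t * x))
    (hf : ∀ w, {t | η w t ≠ 1}.Finite) (n : ℕ) (hn : 1 ≤ n) (x : Fin (n + 1) → W) :
    epsZ η n (x ∘ Fin.succ)
      + ∑ j : Fin n, ((-1 : ℤ) ^ ((j : ℕ) + 1)) • epsZ η n (contract x j)
      + ((-1 : ℤ) ^ (n + 1)) • epsZ η n (x ∘ Fin.castSucc)
      = (1 - (-1) ^ n) * epsZ η (n + 1) x := by
  have hfin := epsE_finite η hf n hn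
  have r : epsZ η n (x ∘ Fin.succ) =
      ∑ᶠ t, epsE η n (x ∘ Fin.succ) ((x 0)⁻¹ * t * x 0) := by
    have := finsum_comp_equiv (MulAut.conj (x 0)⁻¹).toEquiv (f := epsE η n (x ∘ Fin.succ))
    rw [epsZ, ← this]
    simp
  have hfin0 : (Function.support
      (fun t => epsE η n (x ∘ Fin.succ) ((x 0)⁻¹ * t * x 0))).Finite := by
    refine Set.Finite.preimage (f := fun t => (x 0)⁻¹ * t * x 0) ?_ (hfin (x ∘ Fin.succ))
    intro a _ b _ h
    simpa using h
  have hsm : ∀ (c : ℤ) (y : Fin n → W),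
      (Function.support (fun t => c • epsE η n y t)).Finite := fun c y =>
    (hfin y).subset (fun t ht h => ht (by simp only [h, smul_zero]))
  have hsum : (Function.support (fun t => ∑ j : Fin n,
      ((-1 : ℤ) ^ ((j : ℕ) + 1)) • epsE η n (contract x j) t)).Finite := by
    refine (Set.finite_iUnion (fun j : Fin n => hsm ((-1) ^ ((j : ℕ) + 1)) (contract x j))).subset ?_
    intro t ht
    obtain ⟨j, -, hj⟩ := Finset.exists_ne_zero_of_sum_ne_zero ht
    exact Set.mem_iUnion.mpr ⟨j, hj⟩
  rw [r]
  simp only [epsZ]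
  rw [mul_finsum]
  simp only [smul_finsum]
  rw [← finsum_sum_comm _ _ (fun j _ => hsm _ _), ← finsum_add_distrib hfin0 hsum,
    ← finsum_add_distrib _ (hsm _ _)]
  · exact finsum_congr (fun t => epsE_delta η h1 n x t)
  · exact (hfin0.union hsum).subset (Function.support_add _ _)

lemma epsE_collapse (cs : CoxeterSystem M W) (η : W → W → ℤˣ)
    (h : ∀ x y, cs.length (x * y) = cs.length x + cs.length y → ∀ t, η x t ≠ 1 →
      η y (x⁻¹ * t * x) = 1) (i : ℕ) : ∀ (n : ℕ) (x : Fin n → W) (hi : i + 1 < n),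
      cs.length (x ⟨i, by omega⟩ * x ⟨i + 1, hi⟩) =
        cs.length (x ⟨i, by omega⟩) + cs.length (x ⟨i + 1, hi⟩) →
      ∀ t, epsE η n x t = 0 := by
  induction i with
  | zero =>
    intro n x hi hx t
    obtain ⟨n, rfl⟩ : ∃ k, n = k + 2 := ⟨n - 2, by omega⟩
    by_cases h0 : η (x 0) t = 1
    · simp [epsE, epsU, h0]
    · have h2 : η (x 1) ((x 0)⁻¹ * t * x 0) = 1 := h (x 0) (x 1) hx t h0
      simp [epsE, epsU, h2]
  | succ i ih =>
    intro n x hi hx t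
    obtain ⟨n, rfl⟩ : ∃ k, n = k + 1 := ⟨n - 1, by omega⟩
    rw [epsE, ih n (x ∘ Fin.succ) (by omega) hx, mul_zero]

lemma epsE_simple (cs : CoxeterSystem M W) (η : W → W → ℤˣ)
    (h3 : ∀ i, η (cs.simple i) (cs.simple i) = -1) (i : B) (n : ℕ) :
    epsE η n (fun _ => cs.simple i) (cs.simple i) = 1 := by
  induction n with
  | zero => rfl
  | succ n ih =>
    have : (-1 : ℤˣ) ≠ 1 := by decide
    simp only [epsE, epsU, h3, Function.comp_def, this, if_false, one_mul]
    simpa using ih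

lemma epsZ_simple (cs : CoxeterSystem M W) (η : W → W → ℤˣ)
    (h2 : ∀ i t, t ≠ cs.simple i → η (cs.simple i) t = 1)
    (h3 : ∀ i, η (cs.simple i) (cs.simple i) = -1) (i : B) (n : ℕ) (hn : 1 ≤ n) :
    epsZ η n (fun _ => cs.simple i) = 1 := by
  rw [epsZ, finsum_eq_single _ (cs.simple i), epsE_simple cs η h3]
  intro t ht
  obtain ⟨n, rfl⟩ : ∃ k, n = k + 1 := ⟨n - 1, by omega⟩
  simp [epsE, epsU, h2 i t ht]

lemma epsZ_exists (cs : CoxeterSystem M W) (n : ℕ) (hn : 1 ≤ n) :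
    ∃ ζ : (Fin n → W) → ℤ, Collapsing cs n ζ ∧ (∀ i : B, ζ (fun _ => cs.simple i) = 1) ∧
      ∃ ξ : (Fin (n + 1) → W) → ℤ, ∀ x : Fin (n + 1) → W,
        ζ (x ∘ Fin.succ)
          + ∑ j : Fin n, ((-1 : ℤ) ^ ((j : ℕ) + 1)) • ζ (contract x j)
          + ((-1 : ℤ) ^ (n + 1)) • ζ (x ∘ Fin.castSucc) = (1 - (-1) ^ n) * ξ x := by
  obtain ⟨η, h1, h2, h3, hf, h5⟩ := eps_refl' cs
  refine ⟨epsZ η n, ?_, fun i => epsZ_simple cs η h2 h3 i n hn, epsZ η (n + 1),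
    epsZ_delta η h1 hf n hn⟩
  intro x i hi hx
  rw [epsZ]
  simp only [epsE_collapse cs η h5 i n x hi hx, finsum_zero]

end Existence

/-- Theorem 1.1: for every even `n ≥ 2` there is a unique `n`-cocycle
`εₙ^W ∈ Zⁿ(W, ℤ)` (trivial action), and for every odd `n ≥ 1` there is a unique
`n`-cocycle `εₙ^W ∈ Zⁿ(W, 𝔽₂)` (trivial action), which is collapsing and takes the
value `1` on `(s, …, s)` for every simple reflection `s`. -/
theorem exists_unique_eps (cs : CoxeterSystem M W) (n : ℕ) (hn : 1 ≤ n) :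
    (Even n →
      ∃! ζ : (Fin n → W) → ℤ, IsCocycle n ζ ∧ Collapsing cs n ζ ∧
        ∀ i : B, ζ (fun _ => cs.simple i) = 1) ∧
    (Odd n →
      ∃! ζ : (Fin n → W) → ZMod 2, IsCocycle n ζ ∧ Collapsing cs n ζ ∧
        ∀ i : B, ζ (fun _ => cs.simple i) = 1) := by
  refine ⟨fun he => ?_, fun ho => ?_⟩
  · obtain ⟨ζ, hc, hs, ξ, hζ⟩ := epsZ_exists cs n hn
    have hco : IsCocycle n ζ := by
      intro x
      rw [hζ x, he.neg_one_pow, sub_self, zero_mul]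
    exact ⟨ζ, ⟨hco, hc, hs⟩, fun ζ' h => eps_unique cs hn 1 h.1 h.2.1 h.2.2 hco hc hs⟩
  · obtain ⟨ζ, hc, hs, ξ, hζ⟩ := epsZ_exists cs n hn
    have hco : IsCocycle n (fun x => ((ζ x : ℤ) : ZMod 2)) := by
      intro x
      have h := congrArg (Int.cast : ℤ → ZMod 2) (hζ x)
      rw [ho.neg_one_pow, sub_neg_eq_add, one_add_one_eq_two] at h
      have h2 : ((2 : ℤ) : ZMod 2) = 0 := by decide
      rw [Int.cast_mul, h2, zero_mul] at h
      rw [← h]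
      simp [zsmul_eq_mul]
    have hc' : Collapsing cs n (fun x => ((ζ x : ℤ) : ZMod 2)) := by
      intro x i hi h
      simp only [hc x i hi h, Int.cast_zero]
    have hs' : ∀ i : B, (fun x => ((ζ x : ℤ) : ZMod 2)) (fun _ => cs.simple i) = 1 := by
      intro i
      simp only [hs i, Int.cast_one]
    exact ⟨_, ⟨hco, hc', hs'⟩, fun ζ' h => eps_unique cs hn 1 h.1 h.2.1 h.2.2 hco hc' hs'⟩
end

section
/- For $x_1, \ldots, x_n \in W$ and for each $w \in W$ let $\mathbf{T}_w$ denote the set of reflections $t$ with $|tw| < |w|$ (so $\#\mathbf{T}_w = |w|$). Then $\epsilon_n^W(x_1,\ldots,x_n)$ equals the cardinality (for $n$ even), or the parity of the cardinality (for $n$ odd), of $\bigcap_{i=1}^n x_1 \cdots x_{i-1} \mathbf{T}_{x_i}$. -/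
open CoxeterSystem

variable {B W : Type*} [Group W] {M : CoxeterMatrix B}

/-- The set `𝐓(x₁,…,xₙ) = ⋂ᵢ x₁⋯x_{i-1} · 𝐓_{x_i}`, where `𝐓_w` is the set of
reflections `t` with `|tw| < |w|` and `x · 𝐓_y = {x t x⁻¹ : t ∈ 𝐓_y}`. -/
def interT (cs : CoxeterSystem M W) (n : ℕ) (x : Fin n → W) : Set W :=
  ⋂ k : Fin n, {t : W | cs.IsLeftInversion (x k) ((pp x (k : ℕ))⁻¹ * t * pp x (k : ℕ))}

namespace EpsAux

/-- Signed conjugation by a simple reflection. -/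
noncomputable def refl (cs : CoxeterSystem M W) (i : B) : Function.End (W × ZMod 2) :=
  open Classical in
  fun p => (cs.simple i * p.1 * cs.simple i, p.2 + if p.1 = cs.simple i then 1 else 0)

open Classical in
lemma refl_pow (cs : CoxeterSystem M W) (i j : B) (k : ℕ) (t : W) (e : ZMod 2) :
    ((refl cs i * refl cs j) ^ k) (t, e) =
      ((cs.simple i * cs.simple j) ^ k * t * ((cs.simple i * cs.simple j) ^ k)⁻¹,
        e + ∑ l ∈ Finset.range (2 * k),
          if t = cs.simple j * (cs.simple i * cs.simple j) ^ l then 1 else 0) := by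
  induction k with
  | zero => simp; rfl
  | succ k ih =>
    have hi := cs.simple_mul_simple_self i
    have hj := cs.simple_mul_simple_self j
    have hi' := cs.inv_simple i
    have hj' := cs.inv_simple j
    rw [pow_succ']
    change (refl cs i) ((refl cs j) (((refl cs i * refl cs j) ^ k) (t, e))) = _
    rw [ih]
    have hconj : ∀ l : ℕ, cs.simple j * (cs.simple i * cs.simple j) ^ l =
        ((cs.simple i * cs.simple j) ^ l)⁻¹ * cs.simple j := by
      intro l
      induction l with
      | zero => simp
      | succ l ihl =>
        rw [pow_succ, ← mul_assoc, ihl, ← pow_succ, pow_succ', mul_inv_rev, mul_inv_rev, hi', hj',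
          mul_assoc, mul_assoc, mul_assoc]
    have h1 : ((cs.simple i * cs.simple j) ^ k * t * ((cs.simple i * cs.simple j) ^ k)⁻¹
        = cs.simple j) ↔ t = cs.simple j * (cs.simple i * cs.simple j) ^ (2 * k) := by
      rw [two_mul, pow_add, ← mul_assoc, hconj]
      generalize (cs.simple i * cs.simple j) ^ k = r
      constructor
      · intro h
        rw [← h]; simp [mul_assoc]
      · rintro rfl; simp [mul_assoc]
    have h2 : (cs.simple j * ((cs.simple i * cs.simple j) ^ k * t *
        ((cs.simple i * cs.simple j) ^ k)⁻¹) * cs.simple j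
        = cs.simple i) ↔ t = cs.simple j * (cs.simple i * cs.simple j) ^ (2 * k + 1) := by
      have e1 : cs.simple j * (cs.simple i * cs.simple j) ^ (2 * k + 1) =
        ((cs.simple i * cs.simple j) ^ k)⁻¹ * (cs.simple j * cs.simple i * cs.simple j)
          * (cs.simple i * cs.simple j) ^ k := by
        rw [two_mul, add_assoc, pow_add, ← mul_assoc, hconj, pow_succ']
        simp only [mul_assoc]
      rw [e1]
      generalize (cs.simple i * cs.simple j) ^ k = r
      constructor
      · intro h
        rw [← h]
        simp [mul_assoc]
      · rintro rfl
        simp [mul_assoc]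
    simp only [refl, h1, h2, show 2 * (k + 1) = 2 * k + 1 + 1 by ring, Finset.sum_range_succ]
    refine Prod.ext ?_ ?_
    · simp [pow_succ', mul_assoc]
    · simp [add_assoc]

lemma refl_liftable (cs : CoxeterSystem M W) : M.IsLiftable (refl cs) := by
  classical
  intro i j
  funext ⟨t, e⟩
  rw [refl_pow]
  have hm := cs.simple_mul_simple_pow i j
  rw [hm, two_mul, Finset.sum_range_add]
  simp only [pow_add, hm, one_mul, mul_one, inv_one]
  rw [CharTwo.add_self_eq_zero]
  simp; rfl

/-- The action of `W` on signed elements. -/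
noncomputable def act (cs : CoxeterSystem M W) : W →* Function.End (W × ZMod 2) :=
  cs.lift ⟨refl cs, refl_liftable cs⟩

lemma act_simple (cs : CoxeterSystem M W) (i : B) : act cs (cs.simple i) = refl cs i :=
  cs.lift_apply_simple _ i

/-- The left inversion cocycle. -/
noncomputable def L (cs : CoxeterSystem M W) (w t : W) : ZMod 2 := (act cs w⁻¹ (t, 0)).2

lemma act_apply (cs : CoxeterSystem M W) (w t : W) (e : ZMod 2) :
    act cs w (t, e) = (w * t * w⁻¹, e + L cs w⁻¹ t) := by
  unfold L
  rw [inv_inv]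
  induction w using cs.simple_induction_left generalizing t e with
  | one => rw [map_one]; change (t, e) = (_, e + 0); simp
  | mul_simple_left w i ih =>
    rw [map_mul, act_simple]
    change refl cs i (act cs w (t, e)) = (_, e + (refl cs i (act cs w (t, 0))).2)
    rw [ih, ih t 0]
    simp [refl, mul_assoc, add_assoc]

lemma L_mul (cs : CoxeterSystem M W) (x y t : W) :
    L cs (x * y) t = L cs x t + L cs y (x⁻¹ * t * x) := by
  have h : act cs (x * y)⁻¹ (t, 0) = act cs y⁻¹ (act cs x⁻¹ (t, 0)) := by
    rw [mul_inv_rev, map_mul]; rfl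
  rw [act_apply, act_apply, act_apply] at h
  simpa using congrArg Prod.snd h

lemma L_one (cs : CoxeterSystem M W) (t : W) : L cs 1 t = 0 := by
  simpa using L_mul cs 1 1 t

open Classical in
lemma L_simple (cs : CoxeterSystem M W) (i : B) (t : W) :
    L cs (cs.simple i) t = if t = cs.simple i then 1 else 0 := by
  rw [L, cs.inv_simple, act_simple]; simp [refl]

lemma L_self (cs : CoxeterSystem M W) {t : W} (ht : cs.IsReflection t) : L cs t t = 1 := by
  obtain ⟨u, i, rfl⟩ := ht
  have h1 := L_mul cs u u⁻¹ (u * cs.simple i * u⁻¹)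
  rw [mul_inv_cancel, L_one] at h1
  rw [mul_assoc u, L_mul, L_mul, L_simple]
  simp only [mul_assoc, inv_mul_cancel_left, inv_mul_cancel, mul_one, cs.inv_simple, if_true,
    cs.simple_mul_simple_self] at h1 ⊢
  rw [add_left_comm, one_mul, ← h1, add_zero]

lemma mem_lis (cs : CoxeterSystem M W) (ω : List B) (t : W) (h : L cs (cs.wordProd ω) t ≠ 0) :
    t ∈ cs.leftInvSeq ω := by
  induction ω generalizing t with
  | nil => simp [L_one] at h
  | cons i ω ih =>
    rw [cs.wordProd_cons, L_mul, L_simple] at h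
    by_cases hti : t = cs.simple i
    · simp [leftInvSeq, hti]
    · rw [if_neg hti, zero_add] at h
      have := ih _ h
      simp only [leftInvSeq, List.mem_cons, List.mem_map]
      exact Or.inr ⟨_, this, by simp [mul_assoc]⟩

lemma inv_of_L (cs : CoxeterSystem M W) (w t : W) (h : L cs w t ≠ 0) :
    cs.IsLeftInversion w t := by
  obtain ⟨ω, hω, rfl⟩ := cs.exists_isReduced w
  exact cs.isLeftInversion_of_mem_leftInvSeq hω (mem_lis cs ω t h)

lemma inv_iff (cs : CoxeterSystem M W) (w t : W) :
    cs.IsLeftInversion w t ↔ L cs w t ≠ 0 := by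
  refine ⟨fun h h0 => ?_, inv_of_L cs w t⟩
  have h1 : L cs (t * w) t ≠ 0 := by
    rw [L_mul, L_self cs h.1]
    simp [h0]
  have h2 := (inv_of_L cs _ _ h1).2
  rw [← mul_assoc, h.1.mul_self, one_mul] at h2
  exact absurd h.2 (by omega)

lemma inv_finite (cs : CoxeterSystem M W) (w : W) : {t | cs.IsLeftInversion w t}.Finite := by
  obtain ⟨ω, hω, rfl⟩ := cs.exists_isReduced w
  refine (cs.leftInvSeq ω).finite_toSet.subset fun t ht => ?_
  exact mem_lis cs ω t ((inv_iff cs _ _).1 ht)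

lemma inv_mul (cs : CoxeterSystem M W) (x y t : W) :
    cs.IsLeftInversion (x * y) t ↔
      ¬ (cs.IsLeftInversion x t ↔ cs.IsLeftInversion y (x⁻¹ * t * x)) := by
  simp only [inv_iff, L_mul]
  generalize L cs x t = a
  generalize L cs y _ = b
  revert a b; decide

lemma inv_simple (cs : CoxeterSystem M W) (i : B) (t : W) :
    cs.IsLeftInversion (cs.simple i) t ↔ t = cs.simple i := by
  rw [inv_iff, L_simple]; split_ifs with h <;> simp [h]

lemma inv_one (cs : CoxeterSystem M W) (t : W) : ¬ cs.IsLeftInversion 1 t := by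
  rw [inv_iff, L_one]; simp


/-- Prefix products of a sequence. -/
def q (y : ℕ → W) : ℕ → W
  | 0 => 1
  | k + 1 => q y k * y k

/-- Membership condition at position `k`. -/
def P (cs : CoxeterSystem M W) (y : ℕ → W) (k : ℕ) (t : W) : Prop :=
  cs.IsLeftInversion (y k) ((q y k)⁻¹ * t * q y k)

/-- The intersection set for sequences. -/
def S (cs : CoxeterSystem M W) (n : ℕ) (y : ℕ → W) : Set W := {t | ∀ k < n, P cs y k t}

lemma pp_eq (n : ℕ) (y : ℕ → W) (k : ℕ) (hk : k ≤ n) :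
    pp (fun i : Fin n => y i) k = q y k := by
  induction k with
  | zero => simp [pp, q]
  | succ k ih =>
    have := ih (by omega)
    unfold pp at this ⊢
    rw [List.prod_take_succ _ _ (by simp; omega), this]
    simp [q]

lemma interT_eq (cs : CoxeterSystem M W) (n : ℕ) (y : ℕ → W) :
    interT cs n (fun i : Fin n => y i) = S cs n y := by
  ext t
  simp only [interT, S, P, Set.mem_iInter, Set.mem_ofPred_eq]
  constructor
  · intro h k hk
    have := h ⟨k, hk⟩
    rwa [pp_eq n y k hk.le] at this
  · intro h k
    rw [pp_eq n y k k.2.le]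
    exact h k k.2

/-- The `i`-th face of a sequence. -/
def face (y : ℕ → W) (i : ℕ) : ℕ → W := fun k =>
  if k + 1 < i then y k else if k + 1 = i then y k * y (k + 1) else y (k + 1)

lemma q_face_lt (y : ℕ → W) (i k : ℕ) (h : k < i) : q (face y i) k = q y k := by
  induction k with
  | zero => rfl
  | succ k ih => rw [q, q, ih (by omega), face, if_pos h]

lemma q_face_ge (y : ℕ → W) (j k : ℕ) (h : j + 1 ≤ k) : q (face y (j + 1)) k = q y (k + 1) := by
  induction k, h using Nat.le_induction with
  | base => rw [q, q_face_lt _ _ _ (by omega)]; simp [face, q, mul_assoc]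
  | succ k hk ih => rw [q, ih, face, if_neg (by omega), if_neg (by omega)]; rfl

lemma q_face_zero (y : ℕ → W) (k : ℕ) : q (face y 0) k = (y 0)⁻¹ * q y (k + 1) := by
  induction k with
  | zero => simp [q]
  | succ k ih => rw [q, ih, face, if_neg (by omega), if_neg (by omega), mul_assoc]; rfl

lemma P_face_lt (cs : CoxeterSystem M W) (y : ℕ → W) (j k : ℕ) (h : k < j) (t : W) :
    P cs (face y (j + 1)) k t ↔ P cs y k t := by
  rw [P, P, q_face_lt _ _ _ (by omega), face, if_pos (by omega)]

lemma P_face_gt (cs : CoxeterSystem M W) (y : ℕ → W) (j k : ℕ) (h : j < k) (t : W) :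
    P cs (face y (j + 1)) k t ↔ P cs y (k + 1) t := by
  rw [P, P, q_face_ge _ _ _ (by omega), face, if_neg (by omega), if_neg (by omega)]

lemma P_face_eq (cs : CoxeterSystem M W) (y : ℕ → W) (j : ℕ) (t : W) :
    P cs (face y (j + 1)) j t ↔ ¬ (P cs y j t ↔ P cs y (j + 1) t) := by
  rw [P, P, P, q_face_lt _ _ _ (by omega), face, if_neg (by omega), if_pos rfl, inv_mul]
  simp [q, mul_assoc]

lemma P_face_zero (cs : CoxeterSystem M W) (y : ℕ → W) (k : ℕ) (t : W) :
    P cs (face y 0) k t ↔ P cs y (k + 1) (y 0 * t * (y 0)⁻¹) := by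
  rw [P, P, q_face_zero, face, if_neg (by omega), if_neg (by omega)]
  simp [mul_assoc]

/-- Omit condition `j`. -/
def U (cs : CoxeterSystem M W) (n : ℕ) (y : ℕ → W) (j : ℕ) : Set W :=
  {t | ∀ k ≤ n, k ≠ j → P cs y k t}

lemma S_face_mid (cs : CoxeterSystem M W) (n : ℕ) (y : ℕ → W) (j : ℕ) (hj : j < n)
    (hd : ∀ t, ¬ (P cs y j t ∧ P cs y (j + 1) t)) :
    S cs n (face y (j + 1)) = U cs n y j ∪ U cs n y (j + 1) := by
  ext t
  simp only [S, U, Set.mem_ofPred_eq, Set.mem_union]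
  constructor
  · intro h
    have h0 := (P_face_eq cs y j t).1 (h j hj)
    have key : ∀ k ≤ n, k ≠ j → k ≠ j + 1 → P cs y k t := by
      intro k hk h1 h2
      rcases lt_or_gt_of_ne h1 with h3 | h3
      · exact (P_face_lt cs y j k h3 t).1 (h k (by omega))
      · obtain ⟨m, rfl⟩ : ∃ m, k = m + 1 := ⟨k - 1, by omega⟩
        exact (P_face_gt cs y j m (by omega) t).1 (h m (by omega))
    by_cases hp : P cs y j t
    · right
      intro k hk hk'
      by_cases e : k = j
      · rwa [e]
      · exact key k hk e hk'
    · left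
      intro k hk hk'
      by_cases e : k = j + 1
      · rw [e]; tauto
      · exact key k hk hk' e
  · intro h k hk
    have := hd t
    rcases lt_trichotomy k j with h3 | rfl | h3
    · rw [P_face_lt _ _ _ _ h3]
      rcases h with h | h <;> exact h k (by omega) (by omega)
    · rw [P_face_eq]
      rcases h with h | h
      · have := h (k + 1) (by omega) (by omega)
        tauto
      · have := h k (by omega) (by omega)
        tauto
    · rw [P_face_gt _ _ _ _ h3]
      rcases h with h | h <;> exact h (k + 1) (by omega) (by omega)

lemma S_face_succ (cs : CoxeterSystem M W) (n : ℕ) (y : ℕ → W) (j : ℕ) (hj : j < n)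
    (hd : ∀ t, ¬ (P cs y j t ∧ P cs y (j + 1) t)) :
    S cs n (face y (j + 2)) = U cs n y (j + 1) := by
  ext t
  simp only [S, U, Set.mem_ofPred_eq]
  have hdt := hd t
  constructor
  · intro h
    have hPj : P cs y j t := (P_face_lt cs y (j + 1) j (by omega) t).1 (h j hj)
    intro k hk hk'
    rcases lt_or_gt_of_ne hk' with h3 | h3
    · exact (P_face_lt cs y (j + 1) k h3 t).1 (h k (by omega))
    · obtain ⟨m, rfl⟩ : ∃ m, k = m + 1 := ⟨k - 1, by omega⟩
      by_cases e : m = j + 1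
      · subst e
        have := (P_face_eq cs y (j + 1) t).1 (h (j + 1) (by omega))
        tauto
      · exact (P_face_gt cs y (j + 1) m (by omega) t).1 (h m (by omega))
  · intro h k hk
    have hPj : P cs y j t := h j (by omega) (by omega)
    rcases lt_trichotomy k (j + 1) with h3 | rfl | h3
    · rw [P_face_lt _ _ _ _ h3]; exact h k (by omega) (by omega)
    · rw [P_face_eq]
      have := h (j + 1 + 1) (by omega) (by omega)
      tauto
    · rw [P_face_gt _ _ _ _ h3]; exact h (k + 1) (by omega) (by omega)

lemma S_face_pred (cs : CoxeterSystem M W) (n : ℕ) (y : ℕ → W) (j : ℕ) (hj : j + 1 < n)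
    (hd : ∀ t, ¬ (P cs y (j + 1) t ∧ P cs y (j + 2) t)) :
    S cs n (face y (j + 1)) = U cs n y (j + 1) := by
  ext t
  simp only [S, U, Set.mem_ofPred_eq]
  have hdt := hd t
  constructor
  · intro h
    have hPj : P cs y (j + 2) t := (P_face_gt cs y j (j + 1) (by omega) t).1 (h (j + 1) hj)
    intro k hk hk'
    rcases lt_trichotomy k j with h3 | rfl | h3
    · exact (P_face_lt cs y j k h3 t).1 (h k (by omega))
    · have := (P_face_eq cs y k t).1 (h k (by omega))
      tauto
    · obtain ⟨m, rfl⟩ : ∃ m, k = m + 1 := ⟨k - 1, by omega⟩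
      exact (P_face_gt cs y j m (by omega) t).1 (h m (by omega))
  · intro h k hk
    have hPj : P cs y (j + 2) t := h (j + 2) (by omega) (by omega)
    rcases lt_trichotomy k j with h3 | rfl | h3
    · rw [P_face_lt _ _ _ _ h3]; exact h k (by omega) (by omega)
    · rw [P_face_eq]
      have := h k (by omega) (by omega)
      tauto
    · rw [P_face_gt _ _ _ _ h3]; exact h (k + 1) (by omega) (by omega)

lemma S_face_zero (cs : CoxeterSystem M W) (n : ℕ) (y : ℕ → W) :
    (S cs n (face y 0)).ncard = (U cs n y 0).ncard := by
  have : U cs n y 0 = (MulAut.conj (y 0)) '' (S cs n (face y 0)) := by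
    ext t
    simp only [S, U, Set.mem_ofPred_eq, Set.mem_image, MulAut.conj_apply, P_face_zero]
    constructor
    · intro h
      refine ⟨(y 0)⁻¹ * t * y 0, fun k hk => ?_, by simp [mul_assoc]⟩
      simpa [mul_assoc] using h (k + 1) (by omega) (by omega)
    · rintro ⟨u, hu, rfl⟩ k hk hk'
      obtain ⟨m, rfl⟩ : ∃ m, k = m + 1 := ⟨k - 1, by omega⟩
      exact hu m (by omega)
  rw [this, Set.ncard_image_of_injective _ (MulAut.conj (y 0)).injective]

lemma P_finite (cs : CoxeterSystem M W) (y : ℕ → W) (k : ℕ) : {t | P cs y k t}.Finite := by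
  refine ((inv_finite cs (y k)).image (MulAut.conj (q y k))).subset ?_
  intro t ht
  exact ⟨_, ht, by simp [mul_assoc]⟩

lemma U_finite (cs : CoxeterSystem M W) (n : ℕ) (hn : 1 ≤ n) (y : ℕ → W) (j : ℕ) :
    (U cs n y j).Finite := by
  by_cases h : j = 0
  · exact (P_finite cs y 1).subset fun t ht => ht 1 hn (by omega)
  · exact (P_finite cs y 0).subset fun t ht => ht 0 (by omega) (by omega)

lemma ncard_rec (cs : CoxeterSystem M W) (n : ℕ) (y : ℕ → W) (j : ℕ) (hj : j < n)
    (hd : ∀ t, ¬ (P cs y j t ∧ P cs y (j + 1) t)) :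
    (S cs n (face y (j + 1))).ncard =
      (S cs n (face y j)).ncard + (S cs n (face y (j + 2))).ncard := by
  have h1 : (S cs n (face y j)).ncard = (U cs n y j).ncard := by
    cases j with
    | zero => exact S_face_zero cs n y
    | succ j => rw [S_face_pred cs n y j hj hd]
  rw [h1, S_face_succ cs n y j hj hd, S_face_mid cs n y j hj hd]
  refine Set.ncard_union_eq ?_ (U_finite cs n (by omega) y _) (U_finite cs n (by omega) y _)
  rw [Set.disjoint_left]
  intro t h2 h3
  exact hd t ⟨h3 j (by omega) (by omega), h2 (j + 1) (by omega) (by omega)⟩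

section cocycle
variable {A : Type*} [AddCommGroup A]

lemma Z_cocycle (n : ℕ) (ζ : (Fin n → W) → A) (h : IsCocycle n ζ) (y : ℕ → W) :
    ∑ i ∈ Finset.range (n + 2), ((-1 : ℤ) ^ i) • ζ (fun k : Fin n => face y i k) = 0 := by
  have := h (fun k => y k)
  rw [Finset.sum_range_succ, Finset.sum_range_succ', ← Fin.sum_univ_eq_sum_range
    (fun i => ((-1 : ℤ) ^ (i + 1)) • ζ (fun k : Fin n => face y (i + 1) k))]
  rw [← this, add_comm (Finset.sum _ _)]
  congr 1
  · congr 1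
    · simp [face]; rfl
    · refine Finset.sum_congr rfl fun j _ => ?_
      congr 2
      funext k
      simp [face, contract, Fin.ext_iff]
  · congr 2
    funext k
    simp [face]

lemma Z_coll (cs : CoxeterSystem M W) (n : ℕ) (ζ : (Fin n → W) → A) (h : Collapsing cs n ζ)
    (y : ℕ → W) (i : ℕ) (hi : i + 1 < n)
    (hl : cs.length (y i * y (i + 1)) = cs.length (y i) + cs.length (y (i + 1))) :
    ζ (fun k : Fin n => y k) = 0 :=
  h (fun k => y k) ⟨i, by omega⟩ hi hl

lemma Z_rec (cs : CoxeterSystem M W) (n : ℕ) (ζ : (Fin n → W) → A) (h : IsCocycle n ζ)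
    (hc : Collapsing cs n ζ) (y : ℕ → W) (j : ℕ) (hj : j < n)
    (hl : cs.length (y j * y (j + 1)) = cs.length (y j) + cs.length (y (j + 1))) :
    ζ (fun k : Fin n => face y (j + 1) k) =
      ζ (fun k : Fin n => face y j k) + ζ (fun k : Fin n => face y (j + 2) k) := by
  have h0 := Z_cocycle n ζ h y
  have h1 : ∀ i ∈ Finset.range (n + 2), i ∉ ({j, j + 1, j + 2} : Finset ℕ) →
      ((-1 : ℤ) ^ i) • ζ (fun k : Fin n => face y i k) = 0 := by
    intro i hi hi'
    simp only [Finset.mem_insert, Finset.mem_singleton, Finset.mem_range, not_or] at hi hi'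
    have : ζ (fun k : Fin n => face y i k) = 0 := by
      rcases lt_or_gt_of_ne hi'.1 with h3 | h3
      · obtain ⟨m, rfl⟩ : ∃ m, j = m + 1 := ⟨j - 1, by omega⟩
        refine Z_coll cs n ζ hc _ m (by omega) ?_
        simpa only [face, if_neg (show ¬ m + 1 < i by omega), if_neg (show ¬ m + 1 = i by omega),
          if_neg (show ¬ m + 1 + 1 < i by omega), if_neg (show ¬ m + 1 + 1 = i by omega)] using hl
      · refine Z_coll cs n ζ hc _ j (by omega) ?_
        simpa only [face, if_pos (show j + 1 < i by omega),
          if_pos (show j + 1 + 1 < i by omega)] using hl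
    rw [this, smul_zero]
  rw [← Finset.sum_subset (s₁ := {j, j + 1, j + 2}) _ h1] at h0
  · rw [Finset.sum_insert (by simp), Finset.sum_insert (by simp), Finset.sum_singleton] at h0
    rw [pow_add, pow_add] at h0
    rcases neg_one_pow_eq_or ℤ j with e | e <;> rw [e] at h0 <;> simp at h0
    · rw [← sub_eq_zero, ← neg_eq_zero, ← h0]; abel
    · rw [← sub_eq_zero, ← h0]; abel
  · intro i hi
    simp only [Finset.mem_insert, Finset.mem_singleton, Finset.mem_range] at hi ⊢
    omega

lemma Z_one (cs : CoxeterSystem M W) (n : ℕ) (ζ : (Fin n → W) → A) (h : IsCocycle n ζ)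
    (hc : Collapsing cs n ζ) (y : ℕ → W) (j : ℕ) (hj : j < n) (hy : y j = 1) :
    ζ (fun k : Fin n => y k) = 0 := by
  by_cases h1 : j + 1 < n
  · exact Z_coll cs n ζ hc y j h1 (by simp [hy])
  by_cases h2 : j = 0
  · subst h2
    obtain rfl : n = 1 := by omega
    have h3 := Z_cocycle 1 ζ h (fun _ => 1)
    have h4 : (fun k : Fin 1 => y k) = fun _ => 1 := by
      funext k; rw [Subsingleton.elim k 0]; simpa using hy
    rw [h4]
    simpa [Finset.sum_range_succ, face] using h3
  · obtain ⟨m, rfl⟩ : ∃ m, j = m + 1 := ⟨j - 1, by omega⟩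
    exact Z_coll cs n ζ hc y m (by omega) (by simp [hy])

end cocycle

lemma S_one (cs : CoxeterSystem M W) (n : ℕ) (y : ℕ → W) (j : ℕ) (hj : j < n) (hy : y j = 1) :
    S cs n y = ∅ := by
  ext t
  simp only [S, Set.mem_ofPred_eq, Set.mem_empty_iff_false, iff_false]
  intro h
  have := h j hj
  rw [P, hy] at this
  exact inv_one cs _ this

lemma q_simple (cs : CoxeterSystem M W) (y : ℕ → W) (i : B) (k : ℕ)
    (h : ∀ m < k, y m = cs.simple i) (t : W) :
    (q y k)⁻¹ * t * q y k = cs.simple i ↔ t = cs.simple i := by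
  induction k with
  | zero => simp [q]
  | succ k ih =>
    rw [← ih (fun m hm => h m (by omega)), q, h k (by omega)]
    constructor
    · intro e
      rw [mul_inv_rev, cs.inv_simple] at e
      have e2 := congrArg (fun z => cs.simple i * z * cs.simple i) e
      simpa [mul_assoc] using e2
    · intro e
      rw [mul_inv_rev, cs.inv_simple]
      have e2 := congrArg (fun z => cs.simple i * z * cs.simple i) e
      simpa [mul_assoc] using e2

/-- Split entry `k` as `s * (s * y k)`. -/
def split (cs : CoxeterSystem M W) (y : ℕ → W) (i : B) (k : ℕ) : ℕ → W := fun m =>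
  if m < k then y m else if m = k then cs.simple i else
    if m = k + 1 then cs.simple i * y k else y (m - 1)

lemma face_split (cs : CoxeterSystem M W) (y : ℕ → W) (i : B) (k : ℕ) :
    face (split cs y i k) (k + 1) = y := by
  funext m
  unfold face split
  rcases lt_trichotomy m k with h | rfl | h
  · rw [if_pos (by omega), if_pos h]
  · simp
  · simp [show ¬ m < k by omega, show ¬ m + 1 < k by omega, show m ≠ k by omega,
      show ¬ m + 1 = k by omega]

lemma split_disj (cs : CoxeterSystem M W) (y : ℕ → W) (i : B) (k : ℕ)
    (hl : cs.IsLeftDescent (y k) i) (t : W) :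
    ¬ (P cs (split cs y i k) k t ∧ P cs (split cs y i k) (k + 1) t) := by
  rintro ⟨h1, h2⟩
  rw [P, show split cs y i k k = cs.simple i by simp [split], inv_simple] at h1
  rw [P, show split cs y i k (k + 1) = cs.simple i * y k by simp [split], q,
    show split cs y i k k = cs.simple i by simp [split], mul_inv_rev, mul_assoc, mul_assoc,
    ← mul_assoc _ t, ← mul_assoc (_ * t), h1] at h2
  have := h2.2
  unfold IsLeftDescent at hl
  simp at this
  omega

lemma split_length (cs : CoxeterSystem M W) (y : ℕ → W) (i : B) (k : ℕ)
    (hl : cs.IsLeftDescent (y k) i) :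
    cs.length (split cs y i k k * split cs y i k (k + 1)) =
      cs.length (split cs y i k k) + cs.length (split cs y i k (k + 1)) := by
  rw [cs.isLeftDescent_iff] at hl
  simp [split]
  omega

section main
variable {A : Type*} [AddCommGroupWithOne A]

lemma main_simple (cs : CoxeterSystem M W) (n : ℕ) (ζ : (Fin n → W) → A) (h : IsEps cs n ζ)
    (i : B) (d : ℕ) : ∀ (k : ℕ), 1 ≤ k → k + d = n → ∀ (y : ℕ → W),
    (∀ m < k, y m = cs.simple i) → ζ (fun m : Fin n => y m) = ((S cs n y).ncard : A) := by
  induction d with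
  | zero =>
    intro k hk1 hk y hy
    obtain rfl : k = n := by omega
    have e1 : (fun m : Fin k => y m) = fun _ => cs.simple i := by
      funext m; exact hy m m.2
    have e2 : S cs k y = {cs.simple i} := by
      ext t
      simp only [S, P, Set.mem_ofPred_eq, Set.mem_singleton_iff]
      have : ∀ m < k, cs.IsLeftInversion (y m) ((q y m)⁻¹ * t * q y m) ↔ t = cs.simple i := by
        intro m hm
        rw [hy m hm, inv_simple, q_simple cs y i m (fun l hl => hy l (by omega))]
      constructor
      · intro h; exact (this 0 (by omega)).1 (h 0 (by omega))
      · intro h m hm; exact (this m hm).2 h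
    rw [e1, h.2.2 i, e2]; simp
  | succ d ih =>
    intro k hk1 hk y hy
    by_cases hl : cs.IsLeftDescent (y k) i
    · have r1 := Z_rec cs n ζ h.1 h.2.1 (split cs y i k) k (by omega) (split_length cs y i k hl)
      have r2 := ncard_rec cs n (split cs y i k) k (by omega) (split_disj cs y i k hl)
      rw [face_split] at r1 r2
      have hone : face (split cs y i k) k (k - 1) = 1 := by
        obtain ⟨m, rfl⟩ : ∃ m, k = m + 1 := ⟨k - 1, by omega⟩
        simp [face, split, hy]
      rw [Z_one cs n ζ h.1 h.2.1 _ (k - 1) (by omega) hone, zero_add] at r1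
      rw [S_one cs n _ (k - 1) (by omega) hone, Set.ncard_empty, zero_add] at r2
      rw [r1, r2]
      refine ih (k + 1) (by omega) (by omega) _ ?_
      intro m hm
      rw [face, if_pos (by omega), split]
      split_ifs
      · exact hy m (by assumption)
      · rfl
      · omega
      · omega
    · have hz : ζ (fun m : Fin n => y m) = 0 := by
        refine Z_coll cs n ζ h.2.1 y (k - 1) (by omega) ?_
        rw [show k - 1 + 1 = k by omega, hy (k - 1) (by omega), cs.length_simple,
          cs.not_isLeftDescent_iff.1 hl, add_comm]
      have hs : S cs n y = ∅ := by
        ext t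
        simp only [S, Set.mem_ofPred_eq, Set.mem_empty_iff_false, iff_false]
        intro hS
        have h0 := hS 0 (by omega)
        rw [P, hy 0 (by omega), inv_simple, q_simple cs y i 0 (by omega)] at h0
        have hk := hS k (by omega)
        rw [P, (q_simple cs y i k hy t).2 h0] at hk
        exact hl hk.2
      rw [hz, hs]; simp

lemma main_all (cs : CoxeterSystem M W) (n : ℕ) (hn : 1 ≤ n) (ζ : (Fin n → W) → A)
    (h : IsEps cs n ζ) (l : ℕ) : ∀ (y : ℕ → W), cs.length (y 0) = l →
    ζ (fun m : Fin n => y m) = ((S cs n y).ncard : A) := by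
  induction l using Nat.strong_induction_on with
  | _ l ih =>
    intro y hy
    by_cases h1 : y 0 = 1
    · rw [Z_one cs n ζ h.1 h.2.1 y 0 hn h1, S_one cs n y 0 hn h1]; simp
    · obtain ⟨i, hl⟩ := cs.exists_leftDescent_of_ne_one h1
      have r1 := Z_rec cs n ζ h.1 h.2.1 (split cs y i 0) 0 (by omega) (split_length cs y i 0 hl)
      have r2 := ncard_rec cs n (split cs y i 0) 0 (by omega) (split_disj cs y i 0 hl)
      rw [face_split] at r1 r2
      rw [r1, r2, Nat.cast_add]
      congr 1
      · refine ih _ ?_ _ rfl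
        rw [← hy]
        simpa [face, split] using (show cs.length (cs.simple i * y 0) < cs.length (y 0) from hl)
      · refine main_simple cs n ζ h i (n - 1) 1 le_rfl (by omega) _ ?_
        intro m hm
        obtain rfl : m = 0 := by omega
        simp [face, split]

lemma main_fin (cs : CoxeterSystem M W) (n : ℕ) (hn : 1 ≤ n) (ζ : (Fin n → W) → A)
    (h : IsEps cs n ζ) (x : Fin n → W) : ζ x = ((interT cs n x).ncard : A) := by
  obtain ⟨y, rfl⟩ : ∃ y : ℕ → W, x = fun m : Fin n => y m :=
    ⟨fun m => if hm : m < n then x ⟨m, hm⟩ else 1, by funext m; simp⟩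
  rw [interT_eq]
  exact main_all cs n hn ζ h _ y rfl

end main

end EpsAux

/-- Lusztig's formula: `εₙ^W(x₁,…,xₙ)` equals the cardinality of
`⋂ᵢ x₁⋯x_{i-1}𝐓_{x_i}` when `n` is even, and its parity when `n` is odd.  Here
`εₙ^W` is characterized as the unique collapsing `n`-cocycle with trivial
coefficients taking the value `1` on `(s,…,s)` for `s` simple. -/
theorem eps_eq_card_interT (cs : CoxeterSystem M W) (n : ℕ) (hn : 1 ≤ n) :
    (Even n → ∀ ζ : (Fin n → W) → ℤ, IsEps cs n ζ →
      ∀ x : Fin n → W, ζ x = ((interT cs n x).ncard : ℤ)) ∧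
    (Odd n → ∀ ζ : (Fin n → W) → ZMod 2, IsEps cs n ζ →
      ∀ x : Fin n → W, ζ x = ((interT cs n x).ncard : ZMod 2)) := by
  exact ⟨fun _ ζ h x => EpsAux.main_fin cs n hn ζ h x, fun _ ζ h x => EpsAux.main_fin cs n hn ζ h x⟩
end
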